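/- arXiv:2101.10061 — 2 statements merged into one kernel-verified Lean document; each statement's English description precedes it below -/
import Mathlib

section
/- Let V be a four-dimensional real vector space and ω₁, ω₂ ∈ Λ²V* with ω₁² ≠ 0 and ω_i ∧ ω_j = δ_{ij} ω₁² for i,j ∈ {1,2}. Then there exists a basis (v₁,...,v₄) of V with dual basis (v¹,...,v⁴) such that ω₁ = v¹² + v³⁴ and ω₂ = v¹³ − v²⁴. -/
open Module

/-- Wedge product of `k` covectors, as an alternating `k`-form (determinant convention). -/
noncomputable def wedgeCov {V : Type*} [AddCommGroup V] [Module ℝ V] {k : ℕ}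
    (f : Fin k → Module.Dual ℝ V) : V [⋀^Fin k]→ₗ[ℝ] ℝ :=
  Matrix.detRowAlternating.compLinearMap (LinearMap.pi f)

/-- Wedge product of alternating forms (shuffle convention, compatible with `wedgeCov`). -/
noncomputable def aw {V : Type*} [AddCommGroup V] [Module ℝ V] {a b : ℕ}
    (ω : V [⋀^Fin a]→ₗ[ℝ] ℝ) (σ : V [⋀^Fin b]→ₗ[ℝ] ℝ) : V [⋀^Fin (a + b)]→ₗ[ℝ] ℝ :=
  ((TensorProduct.lid ℝ ℝ).toLinearMap.compAlternatingMap (ω.domCoprod σ)).domDomCongr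
    finSumFinEquiv

/-- The `i`-th coordinate covector on `Fin n → ℝ`. -/
noncomputable def pr {n : ℕ} (i : Fin n) : Module.Dual ℝ (Fin n → ℝ) := LinearMap.proj i

theorem four_mul_aw_apply {V : Type*} [AddCommGroup V] [Module ℝ V] (ω σ : V [⋀^Fin 2]→ₗ[ℝ] ℝ)
    (v : Fin 4 → V) : 4 * aw ω σ v = ∑ τ : Equiv.Perm (Fin 4), Equiv.Perm.sign τ •
      (ω ![v (τ 0), v (τ 1)] * σ ![v (τ 2), v (τ 3)]) := by
  have h := congrArg (fun f => TensorProduct.lid ℝ ℝ (f (v ∘ finSumFinEquiv)))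
    (MultilinearMap.domCoprod_alternization_eq ω σ)
  have haw : aw ω σ v = TensorProduct.lid ℝ ℝ ((ω.domCoprod σ) (v ∘ finSumFinEquiv)) := rfl
  rw [AlternatingMap.smul_apply, map_nsmul, ← haw] at h
  norm_num [MultilinearMap.alternatization_apply, -AlternatingMap.domCoprod_apply] at h
  rw [← h]
  refine Fintype.sum_equiv (Equiv.permCongr finSumFinEquiv) _ _ fun τ => ?_
  rw [Equiv.Perm.sign_permCongr]
  congr 3 <;> ext i <;> fin_cases i <;> rfl

theorem sum_perm_fin_succ {M : Type*} [AddCommMonoid M] {n : ℕ}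
    (f : Equiv.Perm (Fin (n + 1)) → M) :
    ∑ τ, f τ = ∑ p, ∑ e, f (Equiv.Perm.decomposeFin.symm (p, e)) := by
  rw [← Fintype.sum_prod_type', ← Equiv.sum_comp Equiv.Perm.decomposeFin.symm]

theorem map_pair_swap {V : Type*} [AddCommGroup V] [Module ℝ V] (ω : V [⋀^Fin 2]→ₗ[ℝ] ℝ)
    (x y : V) : ω ![y, x] = - ω ![x, y] := by
  rw [← ω.map_swap ![x, y] (i := 0) (j := 1) (by decide)]
  congr 1; ext i; fin_cases i <;> simp

theorem aw_two_two_apply {V : Type*} [AddCommGroup V] [Module ℝ V] (ω σ : V [⋀^Fin 2]→ₗ[ℝ] ℝ)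
    (v : Fin 4 → V) : aw ω σ v =
      ω ![v 0, v 1] * σ ![v 2, v 3] - ω ![v 0, v 2] * σ ![v 1, v 3]
      + ω ![v 0, v 3] * σ ![v 1, v 2] + ω ![v 1, v 2] * σ ![v 0, v 3]
      - ω ![v 1, v 3] * σ ![v 0, v 2] + ω ![v 2, v 3] * σ ![v 0, v 1] := by
  have h := four_mul_aw_apply ω σ v
  have h42 (p : Fin 4) (e : Equiv.Perm (Fin 3)) :
      Equiv.Perm.decomposeFin.symm (p, e) 2 = Equiv.swap 0 p (e 1).succ :=
    Equiv.Perm.decomposeFin_symm_apply_succ e p 1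
  have h43 (p : Fin 4) (e : Equiv.Perm (Fin 3)) :
      Equiv.Perm.decomposeFin.symm (p, e) 3 = Equiv.swap 0 p (e 2).succ :=
    Equiv.Perm.decomposeFin_symm_apply_succ e p 2
  have h32 (p : Fin 3) (e : Equiv.Perm (Fin 2)) :
      Equiv.Perm.decomposeFin.symm (p, e) 2 = Equiv.swap 0 p (e 1).succ :=
    Equiv.Perm.decomposeFin_symm_apply_succ e p 1
  simp [sum_perm_fin_succ, Equiv.Perm.decomposeFin.symm_sign, Fin.sum_univ_succ, h42, h43, h32,
    Equiv.swap_apply_def] at h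
  simp only [map_pair_swap _ (v 0), map_pair_swap _ (v 1) (v 2), map_pair_swap _ (v 1) (v 3),
    map_pair_swap _ (v 2) (v 3)] at h
  linarith

/-- The bilinear form underlying an alternating two-form. -/
def pairing {V : Type*} [AddCommGroup V] [Module ℝ V] (ω : V [⋀^Fin 2]→ₗ[ℝ] ℝ) :
    V →ₗ[ℝ] V →ₗ[ℝ] ℝ :=
  LinearMap.mk₂ ℝ (fun x y => ω ![x, y])
    (fun x x' y => ω.map_vecCons_add ![y] x x')
    (fun c x y => ω.map_vecCons_smul ![y] c x)
    (fun x y y' => by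
      rw [map_pair_swap ω y x, map_pair_swap ω y' x, map_pair_swap ω (y + y') x]
      have := ω.map_vecCons_add ![x] y y'
      simp only [Matrix.vecCons] at this ⊢
      linarith)
    (fun c x y => by
      rw [map_pair_swap ω y x, map_pair_swap ω (c • y) x]
      have := ω.map_vecCons_smul ![x] c y
      simp only [Matrix.vecCons, smul_eq_mul] at this ⊢
      linarith)

theorem pairing_apply {V : Type*} [AddCommGroup V] [Module ℝ V] (ω : V [⋀^Fin 2]→ₗ[ℝ] ℝ)
    (x y : V) : pairing ω x y = ω ![x, y] := rfl

theorem pairing_self {V : Type*} [AddCommGroup V] [Module ℝ V] (ω : V [⋀^Fin 2]→ₗ[ℝ] ℝ)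
    (x : V) : pairing ω x x = 0 :=
  ω.map_eq_zero_of_eq ![x, x] (i := 0) (j := 1) rfl (by decide)

theorem pairing_swap {V : Type*} [AddCommGroup V] [Module ℝ V] (ω : V [⋀^Fin 2]→ₗ[ℝ] ℝ)
    (x y : V) : pairing ω y x = -pairing ω x y :=
  map_pair_swap ω x y

theorem prod_pairing_surjective {V : Type*} [AddCommGroup V] [Module ℝ V]
    {ω₁ ω₂ : V [⋀^Fin 2]→ₗ[ℝ] ℝ} (e : Basis (Fin 4) ℝ V)
    (h11 : aw ω₁ ω₁ ≠ 0) (h12 : aw ω₁ ω₂ = 0) (h22 : aw ω₂ ω₂ = aw ω₁ ω₁) :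
    Function.Surjective ((pairing ω₁ (e 0)).prod (pairing ω₂ (e 0))) := by
  have hD : aw ω₁ ω₁ e ≠ 0 := ((aw ω₁ ω₁).map_basis_ne_zero_iff e).2 h11
  have hD12 : aw ω₁ ω₂ e = 0 := by rw [h12]; rfl
  have hD22 : aw ω₂ ω₂ e = aw ω₁ ω₁ e := by rw [h22]
  rw [← LinearMap.dualMap_injective_iff, injective_iff_map_eq_zero]
  intro f hf
  have hf_apply (p q : ℝ) : f (p, q) = p * f (1, 0) + q * f (0, 1) := by
    rw [← smul_eq_mul, ← smul_eq_mul, ← map_smul, ← map_smul, ← map_add]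
    simp
  have hrel (j : Fin 4) : ω₁ ![e 0, e j] * f (1, 0) + ω₂ ![e 0, e j] * f (0, 1) = 0 := by
    rw [← hf_apply]
    exact LinearMap.congr_fun hf (e j)
  generalize f (1, 0) = s at *
  generalize f (0, 1) = t at *
  have hst : (s ^ 2 + t ^ 2) * aw ω₁ ω₁ e = 0 := by
    have h1 := hrel 1
    have h2 := hrel 2
    have h3 := hrel 3
    have hexp : (s ^ 2 + t ^ 2) * aw ω₁ ω₁ e =
        s ^ 2 * aw ω₁ ω₁ e + 2 * (s * t) * aw ω₁ ω₂ e + t ^ 2 * aw ω₂ ω₂ e := by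
      rw [hD12, hD22]; ring
    rw [hexp]
    simp only [aw_two_two_apply]
    linear_combination
      2 * (s * ω₁ ![e 2, e 3] + t * ω₂ ![e 2, e 3]) * h1
      - 2 * (s * ω₁ ![e 1, e 3] + t * ω₂ ![e 1, e 3]) * h2
      + 2 * (s * ω₁ ![e 1, e 2] + t * ω₂ ![e 1, e 2]) * h3
  have hsq := (mul_eq_zero.1 hst).resolve_right hD
  have hs : s = 0 := by nlinarith
  have ht : t = 0 := by nlinarith
  ext <;> simp [hf_apply, hs, ht]

theorem wedgeCov_pair_apply {V : Type*} [AddCommGroup V] [Module ℝ V] (f g : Module.Dual ℝ V)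
    (v : Fin 2 → V) : wedgeCov ![f, g] v = f (v 0) * g (v 1) - g (v 0) * f (v 1) :=
  Matrix.det_fin_two (Matrix.of fun i j => (![f, g] : Fin 2 → Module.Dual ℝ V) j (v i))

/-- Four vectors whose pairings are those of the normal form give a basis in normal form. -/
theorem exists_basis_of_pairing_eq {V : Type*} [AddCommGroup V] [Module ℝ V]
    (hdim : Module.finrank ℝ V = 4) {ω₁ ω₂ : V [⋀^Fin 2]→ₗ[ℝ] ℝ} {v : Fin 4 → V}
    (h₁ : ∀ i j, pairing ω₁ (v i) (v j) =
      !![0, 1, 0, 0; -1, 0, 0, 0; 0, 0, 0, 1; 0, 0, -1, 0] i j)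
    (h₂ : ∀ i j, pairing ω₂ (v i) (v j) =
      !![0, 0, 1, 0; 0, 0, 0, -1; -1, 0, 0, 0; 0, 1, 0, 0] i j) :
    ∃ b : Basis (Fin 4) ℝ V,
      ω₁ = wedgeCov ![b.coord 0, b.coord 1] + wedgeCov ![b.coord 2, b.coord 3] ∧
      ω₂ = wedgeCov ![b.coord 0, b.coord 2] - wedgeCov ![b.coord 1, b.coord 3] := by
  have hli : LinearIndependent ℝ v := by
    rw [Fintype.linearIndependent_iff]
    intro g hg i
    have h (j : Fin 4) := congrArg (pairing ω₁ (v j)) hg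
    simp only [map_sum, map_smul, h₁, map_zero] at h
    have h0 := h 0
    have h1 := h 1
    have h2 := h 2
    have h3 := h 3
    simp [Fin.sum_univ_four] at h0 h1 h2 h3
    fin_cases i <;> assumption
  let b := basisOfLinearIndependentOfCardEqFinrank hli (by simp [hdim])
  have hb : ⇑b = v := coe_basisOfLinearIndependentOfCardEqFinrank _ _
  have hpair (ω : V [⋀^Fin 2]→ₗ[ℝ] ℝ) (k : Fin 2 → Fin 4) :
      (ω fun i => b (k i)) = pairing ω (v (k 0)) (v (k 1)) := by
    rw [hb, pairing_apply]
    congr 1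
    ext i; fin_cases i <;> rfl
  refine ⟨b, b.ext_alternating fun k _ => ?_, b.ext_alternating fun k _ => ?_⟩
  · rw [hpair, h₁, AlternatingMap.add_apply, wedgeCov_pair_apply, wedgeCov_pair_apply]
    simp only [Basis.coord_apply, Basis.repr_self]
    generalize k 0 = i
    generalize k 1 = j
    fin_cases i <;> fin_cases j <;> simp
  · rw [hpair, h₂, AlternatingMap.sub_apply, wedgeCov_pair_apply, wedgeCov_pair_apply]
    simp only [Basis.coord_apply, Basis.repr_self]
    generalize k 0 = i
    generalize k 1 = j
    fin_cases i <;> fin_cases j <;> simp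


/-!  STATEMENT 11.  Let `V` be a four-dimensional real vector space and
`ω₁, ω₂ ∈ Λ²V*` with `ω₁² ≠ 0`, `ω₁ ∧ ω₂ = 0` and `ω₂² = ω₁²`.  Then there is a basis
`(v₁,…,v₄)` of `V` with dual basis `(v¹,…,v⁴)` such that `ω₁ = v¹² + v³⁴` and
`ω₂ = v¹³ − v²⁴`. -/
theorem normal_form_of_pair_of_two_forms
    (V : Type*) [AddCommGroup V] [Module ℝ V] [FiniteDimensional ℝ V]
    (hdim : Module.finrank ℝ V = 4)
    (ω₁ ω₂ : V [⋀^Fin 2]→ₗ[ℝ] ℝ)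
    (h11 : aw ω₁ ω₁ ≠ 0) (h12 : aw ω₁ ω₂ = 0) (h22 : aw ω₂ ω₂ = aw ω₁ ω₁) :
    ∃ b : Basis (Fin 4) ℝ V,
      ω₁ = wedgeCov ![b.coord 0, b.coord 1] + wedgeCov ![b.coord 2, b.coord 3] ∧
      ω₂ = wedgeCov ![b.coord 0, b.coord 2] - wedgeCov ![b.coord 1, b.coord 3] := by
  let e := Module.finBasisOfFinrankEq ℝ V hdim
  have hsurj := prod_pairing_surjective e h11 h12 h22
  set L := (pairing ω₁ (e 0)).prod (pairing ω₂ (e 0)) with hL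
  obtain ⟨y, hy⟩ := hsurj (1, 0)
  obtain ⟨z, hz⟩ := hsurj (0, 1)
  have hker : Module.finrank ℝ (LinearMap.ker L) = 2 := by
    have h := L.finrank_range_add_finrank_ker
    rw [LinearMap.range_eq_top.2 hsurj, finrank_top, hdim] at h
    simp at h
    omega
  have hx : e 0 ∈ LinearMap.ker L := by simp [hL, pairing_self]
  obtain ⟨⟨w, hw⟩, hxw⟩ := exists_linearIndependent_pair_of_one_lt_finrank
    (R := ℝ) (M := LinearMap.ker L) (by omega) (x := ⟨e 0, hx⟩)
    (fun h => e.ne_zero 0 (congrArg Subtype.val h))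
  rw [LinearIndependent.pair_iff] at hxw
  have hxw' (s t : ℝ) (h : s • e 0 + t • w = 0) : s = 0 ∧ t = 0 :=
    hxw s t (Subtype.ext h)
  generalize e 0 = x at *
  have hw0 := LinearMap.mem_ker.1 hw
  rw [hL] at hy hz hw0
  have hy₁ : pairing ω₁ x y = 1 := congrArg Prod.fst hy
  have hy₂ : pairing ω₂ x y = 0 := congrArg Prod.snd hy
  have hz₁ : pairing ω₁ x z = 0 := congrArg Prod.fst hz
  have hz₂ : pairing ω₂ x z = 1 := congrArg Prod.snd hz
  have hw₁ : pairing ω₁ x w = 0 := congrArg Prod.fst hw0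
  have hw₂ : pairing ω₂ x w = 0 := congrArg Prod.snd hw0
  have hli : LinearIndependent ℝ ![x, y, z, w] := by
    rw [Fintype.linearIndependent_iff]
    intro g hg
    simp only [Fin.sum_univ_four, Matrix.cons_val] at hg
    have h1 : g 1 = 0 := by
      simpa [pairing_self, hy₁, hz₁, hw₁] using congrArg (pairing ω₁ x) hg
    have h2 : g 2 = 0 := by
      simpa [pairing_self, hy₂, hz₂, hw₂] using congrArg (pairing ω₂ x) hg
    obtain ⟨h0, h3⟩ := hxw' (g 0) (g 3) (by simpa [h1, h2] using hg)
    intro i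
    fin_cases i <;> assumption
  let b := basisOfLinearIndependentOfCardEqFinrank hli (by simp [hdim])
  have hb : ⇑b = ![x, y, z, w] := coe_basisOfLinearIndependentOfCardEqFinrank _ _
  have hD := ((aw ω₁ ω₁).map_basis_ne_zero_iff b).2 h11
  have hD12 : aw ω₁ ω₂ b = 0 := by rw [h12]; rfl
  have hD22 : aw ω₂ ω₂ b = aw ω₁ ω₁ b := by rw [h22]
  simp only [hb, aw_two_two_apply, ← pairing_apply, Matrix.cons_val, hy₁, hy₂, hz₁, hz₂, hw₁, hw₂]
    at hD hD12 hD22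
  obtain ⟨s, hs⟩ : ∃ s, pairing ω₁ z w = s := ⟨_, rfl⟩
  obtain ⟨t, ht⟩ : ∃ t, pairing ω₁ y w = t := ⟨_, rfl⟩
  have hzw : pairing ω₂ z w = t := by linarith
  have hyw : pairing ω₂ y w = -s := by linarith
  have hs0 : s ≠ 0 := by
    rintro rfl
    exact hD (by rw [hs]; ring)
  let w' := s⁻¹ • (w + t • x)
  let y' := y - pairing ω₂ y z • x + pairing ω₁ y z • w'
  have hyx (ω : V [⋀^Fin 2]→ₗ[ℝ] ℝ) := pairing_swap ω x y
  have hzx (ω : V [⋀^Fin 2]→ₗ[ℝ] ℝ) := pairing_swap ω x z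
  have hwx (ω : V [⋀^Fin 2]→ₗ[ℝ] ℝ) := pairing_swap ω x w
  have hzy (ω : V [⋀^Fin 2]→ₗ[ℝ] ℝ) := pairing_swap ω y z
  have hwy (ω : V [⋀^Fin 2]→ₗ[ℝ] ℝ) := pairing_swap ω y w
  have hwz (ω : V [⋀^Fin 2]→ₗ[ℝ] ℝ) := pairing_swap ω z w
  refine exists_basis_of_pairing_eq (v := ![x, y', z, w']) hdim (fun i j => ?_) fun i j => ?_ <;>
  fin_cases i <;> fin_cases j <;>
  simp [y', w', pairing_self, hyx, hzx, hwx, hzy, hwy, hwz, hy₁, hy₂, hz₁, hz₂, hw₁, hw₂, hs, ht,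
    hzw, hyw, hs0]
end

section
/- On the six-dimensional nilpotent Lie algebra n₂₈ with structure equations de¹ = de² = de³ = de⁴ = 0, de⁵ = e¹³ + e⁴², de⁶ = e¹⁴ + e²³, the pair ω = e¹² + e³⁴ − e⁵⁶, ρ = e¹³⁶ − e¹⁴⁵ − e²³⁵ − e²⁴⁶ is a half-flat SU(3)-structure (d(ω²) = 0 and dρ = 0), and ρ = dν for the primitive (1,1)-form ν = e¹² + e⁵⁶ (i.e. ν is J_ρ-invariant and ν ∧ ω² = 0). -/
open Module

/-- The model `SL(3,ℂ)` three-form `ρ₀ = e¹³⁵ − e¹⁴⁶ − e²³⁶ − e²⁴⁵` on `ℝ⁶` (0-based indices). -/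
noncomputable def rho0 : (Fin 6 → ℝ) [⋀^Fin 3]→ₗ[ℝ] ℝ :=
  wedgeCov ![pr 0, pr 2, pr 4] - wedgeCov ![pr 0, pr 3, pr 5] - wedgeCov ![pr 1, pr 2, pr 5] -
    wedgeCov ![pr 1, pr 3, pr 4]

/-- A three-form on a real vector space is an `SL(3,ℂ)`-structure if it is linearly
equivalent to the model form `ρ₀`. -/
def IsSL3 {V : Type*} [AddCommGroup V] [Module ℝ V] (ρ : V [⋀^Fin 3]→ₗ[ℝ] ℝ) : Prop :=
  ∃ u : V ≃ₗ[ℝ] (Fin 6 → ℝ), ρ = rho0.compLinearMap u.toLinearMap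

/-- The model `SU(3)` two-form `ω₀ = e¹² + e³⁴ + e⁵⁶` on `ℝ⁶` (0-based indices). -/
noncomputable def omega0 : (Fin 6 → ℝ) [⋀^Fin 2]→ₗ[ℝ] ℝ :=
  wedgeCov ![pr 0, pr 1] + wedgeCov ![pr 2, pr 3] + wedgeCov ![pr 4, pr 5]

/-- A pair of a two-form and a three-form is an `SU(3)`-structure if it is linearly
equivalent to the model pair `(ω₀, ρ₀)`. -/
def IsSU3 {V : Type*} [AddCommGroup V] [Module ℝ V] (ω : V [⋀^Fin 2]→ₗ[ℝ] ℝ)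
    (ρ : V [⋀^Fin 3]→ₗ[ℝ] ℝ) : Prop :=
  ∃ u : V ≃ₗ[ℝ] (Fin 6 → ℝ), ω = omega0.compLinearMap u.toLinearMap ∧
    ρ = rho0.compLinearMap u.toLinearMap

/-- Chevalley–Eilenberg differential of a 2-form, relative to a bracket `B`, evaluated
pointwise: `dν(x,y,z) = −ν(B x y, z) + ν(B x z, y) − ν(B y z, x)`. -/
noncomputable def d2CE {V : Type*} [AddCommGroup V] [Module ℝ V] (B : V → V → V)
    (ν : V [⋀^Fin 2]→ₗ[ℝ] ℝ) (x y z : V) : ℝ :=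
  -ν ![B x y, z] + ν ![B x z, y] - ν ![B y z, x]

/-- Chevalley–Eilenberg differential of a 3-form, relative to a bracket `B`, evaluated
pointwise. -/
noncomputable def d3CE {V : Type*} [AddCommGroup V] [Module ℝ V] (B : V → V → V)
    (ρ : V [⋀^Fin 3]→ₗ[ℝ] ℝ) (x y z w : V) : ℝ :=
  -ρ ![B x y, z, w] + ρ ![B x z, y, w] - ρ ![B x w, y, z]
    - ρ ![B y z, x, w] + ρ ![B y w, x, z] - ρ ![B z w, x, y]

/-- Chevalley–Eilenberg differential of a 4-form, relative to a bracket `B`, evaluated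
pointwise. -/
noncomputable def d4CE {V : Type*} [AddCommGroup V] [Module ℝ V] (B : V → V → V)
    (σ : V [⋀^Fin 4]→ₗ[ℝ] ℝ) (a b c d e : V) : ℝ :=
  -σ ![B a b, c, d, e] + σ ![B a c, b, d, e] - σ ![B a d, b, c, e] + σ ![B a e, b, c, d]
    - σ ![B b c, a, d, e] + σ ![B b d, a, c, e] - σ ![B b e, a, c, d]
    - σ ![B c d, a, b, e] + σ ![B c e, a, b, d] - σ ![B d e, a, b, c]

/-- The Lie bracket of the six-dimensional nilpotent Lie algebra `n₂₈ = (0,0,0,0,13+42,14+23)`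
(0-based coordinates on `ℝ⁶`): dual to `de⁵ = e¹³ + e⁴²`, `de⁶ = e¹⁴ + e²³`. -/
noncomputable def B28 (x y : Fin 6 → ℝ) : Fin 6 → ℝ :=
  ![0, 0, 0, 0, -(x 0 * y 2 - x 2 * y 0 + x 3 * y 1 - x 1 * y 3),
    -(x 0 * y 3 - x 3 * y 0 + x 1 * y 2 - x 2 * y 1)]

/-- `J_ρ` for the adapted basis `(e¹,e²,e³,e⁴,e⁶,e⁵)` (0-based coordinates). -/
noncomputable def J12 (x : Fin 6 → ℝ) : Fin 6 → ℝ := ![x 1, -x 0, x 3, -x 2, -x 5, x 4]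

/-- `ω = e¹² + e³⁴ − e⁵⁶` (0-based). -/
noncomputable def om12 : (Fin 6 → ℝ) [⋀^Fin 2]→ₗ[ℝ] ℝ :=
  wedgeCov ![pr 0, pr 1] + wedgeCov ![pr 2, pr 3] - wedgeCov ![pr 4, pr 5]

/-- `ρ = e¹³⁶ − e¹⁴⁵ − e²³⁵ − e²⁴⁶` (0-based). -/
noncomputable def rh12 : (Fin 6 → ℝ) [⋀^Fin 3]→ₗ[ℝ] ℝ :=
  wedgeCov ![pr 0, pr 2, pr 5] - wedgeCov ![pr 0, pr 3, pr 4] - wedgeCov ![pr 1, pr 2, pr 4] -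
    wedgeCov ![pr 1, pr 3, pr 5]

/-- `ν = e¹² + e⁵⁶` (0-based). -/
noncomputable def nu12 : (Fin 6 → ℝ) [⋀^Fin 2]→ₗ[ℝ] ℝ :=
  wedgeCov ![pr 0, pr 1] + wedgeCov ![pr 4, pr 5]

theorem wedgeCov_apply {V : Type*} [AddCommGroup V] [Module ℝ V] {k : ℕ}
    (f : Fin k → Module.Dual ℝ V) (v : Fin k → V) :
    wedgeCov f v = (Matrix.of fun i j => f j (v i)).det := rfl

theorem wedgeCov_eq_alternatization {V : Type*} [AddCommGroup V] [Module ℝ V] {k : ℕ}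
    (f : Fin k → Module.Dual ℝ V) :
    wedgeCov f =
      MultilinearMap.alternatization
        ((MultilinearMap.mkPiAlgebra ℝ (Fin k) ℝ).compLinearMap f) := by
  ext v
  rw [wedgeCov_apply, Matrix.det_apply, MultilinearMap.alternatization_apply]
  rfl

theorem aw_wedgeCov {V : Type*} [AddCommGroup V] [Module ℝ V] {a b : ℕ}
    (f : Fin a → Module.Dual ℝ V) (g : Fin b → Module.Dual ℝ V) :
    aw (wedgeCov f) (wedgeCov g) = wedgeCov (Fin.append f g) := by
  ext v
  rw [aw, wedgeCov_eq_alternatization f, wedgeCov_eq_alternatization g,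
    ← MultilinearMap.domCoprod_alternization, wedgeCov_eq_alternatization]
  simp only [AlternatingMap.domDomCongr_apply, LinearMap.compAlternatingMap_apply,
    MultilinearMap.alternatization_apply, map_sum]
  refine Fintype.sum_equiv (finSumFinEquiv.permCongr) _ _ fun σ => ?_
  rw [Equiv.Perm.sign_permCongr]
  simp only [map_zsmul, Units.smul_def]
  congr 1
  simp [Fin.prod_univ_add]

theorem aw_add_left {V : Type*} [AddCommGroup V] [Module ℝ V] {a b : ℕ}
    (ω₁ ω₂ : V [⋀^Fin a]→ₗ[ℝ] ℝ) (σ : V [⋀^Fin b]→ₗ[ℝ] ℝ) :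
    aw (ω₁ + ω₂) σ = aw ω₁ σ + aw ω₂ σ := by
  have h : (ω₁ + ω₂).domCoprod σ = ω₁.domCoprod σ + ω₂.domCoprod σ := by
    simp only [← AlternatingMap.domCoprod'_apply, TensorProduct.add_tmul, map_add]
  ext v
  simp [aw, h]

theorem aw_sub_left {V : Type*} [AddCommGroup V] [Module ℝ V] {a b : ℕ}
    (ω₁ ω₂ : V [⋀^Fin a]→ₗ[ℝ] ℝ) (σ : V [⋀^Fin b]→ₗ[ℝ] ℝ) :
    aw (ω₁ - ω₂) σ = aw ω₁ σ - aw ω₂ σ := by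
  rw [eq_sub_iff_add_eq, ← aw_add_left, sub_add_cancel]

theorem aw_add_right {V : Type*} [AddCommGroup V] [Module ℝ V] {a b : ℕ}
    (ω : V [⋀^Fin a]→ₗ[ℝ] ℝ) (σ₁ σ₂ : V [⋀^Fin b]→ₗ[ℝ] ℝ) :
    aw ω (σ₁ + σ₂) = aw ω σ₁ + aw ω σ₂ := by
  have h : ω.domCoprod (σ₁ + σ₂) = ω.domCoprod σ₁ + ω.domCoprod σ₂ := by
    simp only [← AlternatingMap.domCoprod'_apply, TensorProduct.tmul_add, map_add]
  ext v
  simp [aw, h]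

theorem aw_sub_right {V : Type*} [AddCommGroup V] [Module ℝ V] {a b : ℕ}
    (ω : V [⋀^Fin a]→ₗ[ℝ] ℝ) (σ₁ σ₂ : V [⋀^Fin b]→ₗ[ℝ] ℝ) :
    aw ω (σ₁ - σ₂) = aw ω σ₁ - aw ω σ₂ := by
  rw [eq_sub_iff_add_eq, ← aw_add_right, sub_add_cancel]

theorem wedgeCov_eq_zero {V : Type*} [AddCommGroup V] [Module ℝ V] {k : ℕ}
    (f : Fin k → Module.Dual ℝ V) {i j : Fin k} (hij : i ≠ j) (h : f i = f j) :
    wedgeCov f = 0 := by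
  ext v
  rw [wedgeCov_apply]
  exact Matrix.det_zero_of_column_eq hij fun l => by simp [h]

theorem wedgeCov_comp_perm {V : Type*} [AddCommGroup V] [Module ℝ V] {k : ℕ}
    (f : Fin k → Module.Dual ℝ V) (σ : Equiv.Perm (Fin k)) :
    wedgeCov (f ∘ σ) = (Equiv.Perm.sign σ : ℤ) • wedgeCov f := by
  ext v
  rw [AlternatingMap.smul_apply, wedgeCov_apply, wedgeCov_apply, zsmul_eq_mul,
    ← Matrix.det_permute']
  rfl

theorem aw_om12_om12 : aw om12 om12 =
    (2 : ℝ) • (wedgeCov ![pr 0, pr 1, pr 2, pr 3] - wedgeCov ![pr 0, pr 1, pr 4, pr 5] -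
      wedgeCov ![pr 2, pr 3, pr 4, pr 5]) := by
  have wedge : ∀ a b c d : Module.Dual ℝ (Fin 6 → ℝ),
      aw (wedgeCov ![a, b]) (wedgeCov ![c, d]) = wedgeCov ![a, b, c, d] := by
    intro a b c d
    rw [aw_wedgeCov]
    congr 1
    ext i : 1
    fin_cases i <;> rfl
  have comm : ∀ a b c d : Module.Dual ℝ (Fin 6 → ℝ),
      wedgeCov ![c, d, a, b] = wedgeCov ![a, b, c, d] := by
    intro a b c d
    have h := wedgeCov_comp_perm ![a, b, c, d] (finRotate 4 ^ 2)
    have hs : Equiv.Perm.sign (finRotate 4 ^ 2) = 1 := by decide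
    rw [hs, Units.val_one, one_smul] at h
    rw [← h]
    congr 1
    ext i : 1
    fin_cases i <;> rfl
  have sq : ∀ a b : Module.Dual ℝ (Fin 6 → ℝ), wedgeCov ![a, b, a, b] = 0 := fun a b =>
    wedgeCov_eq_zero _ (i := 0) (j := 2) (by decide) rfl
  simp only [om12, aw_add_left, aw_sub_left, aw_add_right, aw_sub_right, wedge, sq]
  rw [comm (pr 0) (pr 1) (pr 2) (pr 3), comm (pr 0) (pr 1) (pr 4) (pr 5),
    comm (pr 2) (pr 3) (pr 4) (pr 5)]
  module

theorem aw_nu12_aw_om12_om12 : aw nu12 (aw om12 om12) = 0 := by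
  have wedge : ∀ a b c d e f : Module.Dual ℝ (Fin 6 → ℝ),
      aw (wedgeCov ![a, b]) (wedgeCov ![c, d, e, f]) = wedgeCov ![a, b, c, d, e, f] := by
    intro a b c d e f
    rw [aw_wedgeCov]
    congr 1
    ext i : 1
    fin_cases i <;> rfl
  have rotate : ∀ a b c d e f : Module.Dual ℝ (Fin 6 → ℝ),
      wedgeCov ![e, f, a, b, c, d] = wedgeCov ![a, b, c, d, e, f] := by
    intro a b c d e f
    have h := wedgeCov_comp_perm ![a, b, c, d, e, f] (finRotate 6 ^ 4)
    have hs : Equiv.Perm.sign (finRotate 6 ^ 4) = 1 := by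
      rw [map_pow, sign_finRotate]
      decide
    rw [hs, Units.val_one, one_smul] at h
    rw [← h]
    congr 1
    ext i : 1
    fin_cases i <;> rfl
  have repeat_first : ∀ a b c d : Module.Dual ℝ (Fin 6 → ℝ),
      wedgeCov ![a, b, a, b, c, d] = 0 := fun a b c d =>
    wedgeCov_eq_zero _ (i := 0) (j := 2) (by decide) rfl
  have repeat_last : ∀ a b c d : Module.Dual ℝ (Fin 6 → ℝ),
      wedgeCov ![a, b, c, d, a, b] = 0 := fun a b c d =>
    wedgeCov_eq_zero _ (i := 0) (j := 4) (by decide) rfl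
  rw [aw_om12_om12, two_smul]
  simp only [nu12, aw_add_left, aw_add_right, aw_sub_right, wedge, repeat_first, repeat_last]
  rw [rotate (pr 0) (pr 1) (pr 2) (pr 3) (pr 4) (pr 5)]
  module

theorem isSU3_om12_rh12 : IsSU3 om12 rh12 := by
  refine ⟨LinearEquiv.funCongrLeft ℝ ℝ (Equiv.swap 4 5), ?_, ?_⟩
  · ext v
    simp [om12, omega0, wedgeCov_apply, Matrix.det_fin_two, pr, Equiv.swap_apply_def]
    ring
  · ext v
    simp [rh12, rho0, wedgeCov_apply, Matrix.det_fin_three, pr, Equiv.swap_apply_def]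

theorem det_fin_four (M : Matrix (Fin 4) (Fin 4) ℝ) :
    M.det =
      M 0 0 * (M 1 1 * (M 2 2 * M 3 3 - M 2 3 * M 3 2) - M 1 2 * (M 2 1 * M 3 3 - M 2 3 * M 3 1) +
        M 1 3 * (M 2 1 * M 3 2 - M 2 2 * M 3 1)) -
      M 0 1 * (M 1 0 * (M 2 2 * M 3 3 - M 2 3 * M 3 2) - M 1 2 * (M 2 0 * M 3 3 - M 2 3 * M 3 0) +
        M 1 3 * (M 2 0 * M 3 2 - M 2 2 * M 3 0)) +
      M 0 2 * (M 1 0 * (M 2 1 * M 3 3 - M 2 3 * M 3 1) - M 1 1 * (M 2 0 * M 3 3 - M 2 3 * M 3 0) +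
        M 1 3 * (M 2 0 * M 3 1 - M 2 1 * M 3 0)) -
      M 0 3 * (M 1 0 * (M 2 1 * M 3 2 - M 2 2 * M 3 1) - M 1 1 * (M 2 0 * M 3 2 - M 2 2 * M 3 0) +
        M 1 2 * (M 2 0 * M 3 1 - M 2 1 * M 3 0)) := by
  rw [Matrix.det_succ_row_zero]
  simp [Fin.sum_univ_succ, Matrix.det_fin_three, Fin.succAbove]
  ring

/-- `ω²` contracted with a vector of the centre, spanned by the last two basis vectors. -/
theorem aw_om12_om12_apply_center (p q : ℝ) (x y z : Fin 6 → ℝ) :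
    (aw om12 om12 : (Fin 6 → ℝ) [⋀^Fin 4]→ₗ[ℝ] ℝ) ![![0, 0, 0, 0, p, q], x, y, z] =
      2 * (q * (wedgeCov ![pr 0, pr 1, pr 4] ![x, y, z] + wedgeCov ![pr 2, pr 3, pr 4] ![x, y, z]) -
        p * (wedgeCov ![pr 0, pr 1, pr 5] ![x, y, z] +
          wedgeCov ![pr 2, pr 3, pr 5] ![x, y, z])) := by
  rw [aw_om12_om12]
  simp [wedgeCov_apply, det_fin_four, Matrix.det_fin_three, pr]
  ring

theorem d4CE_aw_om12_om12 (a b c d e : Fin 6 → ℝ) :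
    d4CE B28 (aw om12 om12 : (Fin 6 → ℝ) [⋀^Fin 4]→ₗ[ℝ] ℝ) a b c d e = 0 := by
  simp only [d4CE, B28, aw_om12_om12_apply_center]
  simp only [wedgeCov_apply, Matrix.det_fin_three, Matrix.of_apply, pr, LinearMap.proj_apply,
    Matrix.cons_val]
  ring

/-!  STATEMENT 12.  On the nilpotent Lie algebra `n₂₈` (bracket `B28`), the pair
`(ω, ρ) = (e¹²+e³⁴−e⁵⁶, e¹³⁶−e¹⁴⁵−e²³⁵−e²⁴⁶)` is a half-flat `SU(3)`-structure
(`d(ω²) = 0` and `dρ = 0`), and `ρ = dν` for the primitive `(1,1)`-form `ν = e¹² + e⁵⁶`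
(`J_ρ`-invariant and `ν ∧ ω² = 0`). -/
theorem n28_halfflat_su3_with_exact_rho_and_primitive_potential :
    IsSU3 om12 rh12 ∧
    (∀ a b c d e : Fin 6 → ℝ,
      d4CE B28 (aw om12 om12 : (Fin 6 → ℝ) [⋀^Fin 4]→ₗ[ℝ] ℝ) a b c d e = 0) ∧
    (∀ x y z w : Fin 6 → ℝ, d3CE B28 rh12 x y z w = 0) ∧
    (∀ x y z : Fin 6 → ℝ, d2CE B28 nu12 x y z = rh12 ![x, y, z]) ∧
    (∀ x y : Fin 6 → ℝ, nu12 ![J12 x, J12 y] = nu12 ![x, y]) ∧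
    aw nu12 (aw om12 om12) = 0 := by
  refine ⟨isSU3_om12_rh12, d4CE_aw_om12_om12, ?_, ?_, ?_, aw_nu12_aw_om12_om12⟩
  · intro x y z w
    simp [d3CE, B28, rh12, wedgeCov_apply, Matrix.det_fin_three, pr]
    ring
  · intro x y z
    simp [d2CE, B28, nu12, rh12, wedgeCov_apply, Matrix.det_fin_two, Matrix.det_fin_three, pr]
    ring
  · intro x y
    simp [J12, nu12, wedgeCov_apply, Matrix.det_fin_two, pr]
    ring
end
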